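/- For every fixed t > 0, the function Q(β;t) = −(∂ϑ/∂β)(β;t) / sin(2πβ), defined for β ∈ ℝ with sin(2πβ) ≠ 0, is strictly positive, satisfies Q(β+1;t) = Q(β;t) and Q(−β;t) = Q(β;t), and is strictly decreasing in β on (0,1/2) (hence strictly increasing on (1/2,1)). -/

import Mathlib

/-- The one-dimensional theta function `ϑ(β;t) = ∑_{k∈ℤ} exp(−πt(k+β)²)`. -/
noncomputable def jacobiThetaShift (β t : ℝ) : ℝ :=
  ∑' k : ℤ, Real.exp (-Real.pi * t * ((k : ℝ) + β) ^ 2)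

/-- Montgomery's quotient `Q(β;t) = −(∂ϑ/∂β)(β;t) / sin(2πβ)`. -/
noncomputable def Qquot (t β : ℝ) : ℝ :=
  -(deriv (fun b => jacobiThetaShift b t) β) / Real.sin (2 * Real.pi * β)

/-- The reciprocal `1 / ∏_{j=1}^{m} (1 - Q^j)` of a finite `Q`-Pochhammer symbol,
extended by `0` to negative `m`. -/
noncomputable def invQPoch (Q : ℝ) (m : ℤ) : ℝ :=
  if m < 0 then 0 else (∏ j ∈ Finset.range m.toNat, (1 - Q ^ (j + 1)))⁻¹

lemma invQPoch_of_neg (Q : ℝ) {m : ℤ} (hm : m < 0) : invQPoch Q m = 0 := if_pos hm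

lemma invQPoch_zero (Q : ℝ) : invQPoch Q 0 = 1 := by simp [invQPoch]

lemma invQPoch_nonneg {Q : ℝ} (h0 : 0 < Q) (h1 : Q < 1) (m : ℤ) : 0 ≤ invQPoch Q m := by
  unfold invQPoch
  split_ifs with h
  · exact le_rfl
  · exact inv_nonneg.2 (Finset.prod_nonneg fun j _ =>
      sub_nonneg.2 (pow_le_one₀ h0.le h1.le))

lemma invQPoch_pos {Q : ℝ} (h0 : 0 < Q) (h1 : Q < 1) {m : ℤ} (hm : 0 ≤ m) :
    0 < invQPoch Q m := by
  rw [invQPoch, if_neg (not_lt.2 hm)]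
  exact inv_pos.2 (Finset.prod_pos fun j _ =>
    sub_pos.2 (pow_lt_one₀ h0.le h1 (Nat.succ_ne_zero j)))

lemma invQPoch_sub_one {Q : ℝ} (h0 : 0 < Q) (h1 : Q < 1) (m : ℤ) :
    invQPoch Q (m - 1) = (1 - Q ^ m) * invQPoch Q m := by
  rcases lt_trichotomy m 0 with hm | rfl | hm
  · rw [invQPoch_of_neg Q hm, invQPoch_of_neg Q (by lia), mul_zero]
  · simp [invQPoch]
  · obtain ⟨n, rfl⟩ : ∃ n : ℕ, m = n + 1 := ⟨(m - 1).toNat, by lia⟩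
    have h : (1 - Q ^ (n + 1)) ≠ 0 := (sub_pos.2 (pow_lt_one₀ h0.le h1 (Nat.succ_ne_zero n))).ne'
    have e1 : ((n : ℤ) + 1 - 1).toNat = n := by simp
    have e2 : ((n : ℤ) + 1).toNat = n + 1 := by lia
    have e3 : Q ^ ((n : ℤ) + 1) = Q ^ (n + 1) := by exact_mod_cast zpow_natCast Q (n + 1)
    rw [invQPoch, invQPoch, if_neg (by lia), if_neg (by lia), e1, e2, e3, Finset.prod_range_succ,
      mul_inv_rev, mul_inv_cancel_left₀ h]

/-- The coefficient recurrence behind the finite Jacobi triple product. -/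
lemma invQPoch_recurrence {q : ℝ} (h0 : 0 < q) (h1 : q < 1) (n k : ℤ) :
    (1 + q ^ (4 * n + 2)) * (q ^ (k ^ 2) * (invQPoch (q ^ 2) (n - k) * invQPoch (q ^ 2) (n + k)))
      + q ^ (2 * n + 1) * (q ^ ((k - 1) ^ 2) *
        (invQPoch (q ^ 2) (n - (k - 1)) * invQPoch (q ^ 2) (n + (k - 1))))
      + q ^ (2 * n + 1) * (q ^ ((k + 1) ^ 2) *
        (invQPoch (q ^ 2) (n - (k + 1)) * invQPoch (q ^ 2) (n + (k + 1))))
    = (1 - (q ^ 2) ^ (2 * n + 1)) * (1 - (q ^ 2) ^ (2 * n + 2)) * (q ^ (k ^ 2) *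
        (invQPoch (q ^ 2) (n + 1 - k) * invQPoch (q ^ 2) (n + 1 + k))) := by
  have hQ0 : 0 < q ^ 2 := by positivity
  have hQ1 : q ^ 2 < 1 := pow_lt_one₀ h0.le h1 two_ne_zero
  have a1 := invQPoch_sub_one hQ0 hQ1 (n + 1 - k)
  have a2 := invQPoch_sub_one hQ0 hQ1 (n - k)
  have b1 := invQPoch_sub_one hQ0 hQ1 (n + 1 + k)
  have b2 := invQPoch_sub_one hQ0 hQ1 (n + k)
  rw [show n + 1 - k - 1 = n - k by ring] at a1
  rw [show n + 1 + k - 1 = n + k by ring] at b1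
  rw [show n - (k - 1) = n + 1 - k by ring, show n + (k - 1) = n + k - 1 by ring,
    show n - (k + 1) = n - k - 1 by ring, show n + (k + 1) = n + 1 + k by ring,
    a2, b2, a1, b1]
  generalize invQPoch (q ^ 2) (n + 1 - k) = u
  generalize invQPoch (q ^ 2) (n + 1 + k) = v
  have hq : q ≠ 0 := h0.ne'
  have hz (m : ℤ) : (q ^ 2) ^ m = q ^ (2 * m) := by
    rw [zpow_mul]; norm_cast
  simp only [hz]
  have e1 : q ^ (2 * (n + 1 - k)) = q ^ (2 * (n - k)) * q ^ 2 := by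
    rw [← zpow_natCast, ← zpow_add₀ hq]; congr 1; push_cast; ring
  have e2 : q ^ (2 * (n + 1 + k)) = q ^ (2 * (n + k)) * q ^ 2 := by
    rw [← zpow_natCast, ← zpow_add₀ hq]; congr 1; push_cast; ring
  have e3 : q ^ (2 * (2 * n + 1)) = q ^ (2 * (n - k)) * q ^ (2 * (n + k)) * q ^ 2 := by
    rw [← zpow_natCast, ← zpow_add₀ hq, ← zpow_add₀ hq]; congr 1; push_cast; ring
  have e4 : q ^ (2 * (2 * n + 2)) = q ^ (2 * (n - k)) * q ^ (2 * (n + k)) * q ^ 4 := by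
    rw [← zpow_natCast, ← zpow_add₀ hq, ← zpow_add₀ hq]; congr 1; push_cast; ring
  have e5 : q ^ (4 * n + 2) = q ^ (2 * (n - k)) * q ^ (2 * (n + k)) * q ^ 2 := by
    rw [← zpow_natCast, ← zpow_add₀ hq, ← zpow_add₀ hq]; congr 1; push_cast; ring
  have e6 : q ^ (2 * n + 1) * q ^ ((k - 1) ^ 2) = q ^ (k ^ 2) * (q ^ (2 * (n - k)) * q ^ 2) := by
    rw [← zpow_natCast, ← zpow_add₀ hq, ← zpow_add₀ hq, ← zpow_add₀ hq]
    congr 1; push_cast; ring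
  have e7 : q ^ (2 * n + 1) * q ^ ((k + 1) ^ 2) = q ^ (k ^ 2) * (q ^ (2 * (n + k)) * q ^ 2) := by
    rw [← zpow_natCast, ← zpow_add₀ hq, ← zpow_add₀ hq, ← zpow_add₀ hq]
    congr 1; push_cast; ring
  rw [← mul_assoc (q ^ (2 * n + 1)), ← mul_assoc (q ^ (2 * n + 1)), e1, e2, e3, e4, e5, e6, e7]
  ring

/-- The finite Jacobi triple product. -/
lemma hasSum_finite_jacobi_triple_product {q : ℝ} (h0 : 0 < q) (h1 : q < 1) {z : ℂ} (hz : z ≠ 0)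
    (n : ℕ) :
    HasSum (fun k : ℤ => ((q ^ (k ^ 2) *
        (invQPoch (q ^ 2) (n - k) * invQPoch (q ^ 2) (n + k)) : ℝ) : ℂ) * z ^ k)
      ((invQPoch (q ^ 2) (2 * n) : ℝ) *
        ∏ r ∈ Finset.range n, (1 + (q : ℂ) ^ (4 * r + 2) + (q : ℂ) ^ (2 * r + 1) * (z + z⁻¹))) := by
  have hQ0 : 0 < q ^ 2 := by positivity
  have hQ1 : q ^ 2 < 1 := pow_lt_one₀ h0.le h1 two_ne_zero
  induction n with
  | zero =>
    convert hasSum_single (0 : ℤ) ?_ using 1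
    · simp [invQPoch_zero]
    · intro k hk
      rcases lt_or_gt_of_ne hk with h | h
      · simp [invQPoch_of_neg _ h]
      · simp [invQPoch_of_neg (q ^ 2) (show -k < 0 by lia)]
  | succ n ih =>
    set c : ℤ → ℝ := fun k => q ^ (k ^ 2) *
      (invQPoch (q ^ 2) (n - k) * invQPoch (q ^ 2) (n + k)) with hc
    have up := (Equiv.subRight (1 : ℤ)).hasSum_iff.2 (ih.mul_right z)
    have hup (k : ℤ) : ((fun k : ℤ => (c k : ℂ) * z ^ k * z) ∘ Equiv.subRight (1 : ℤ)) k =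
        (c (k - 1) : ℂ) * z ^ k := by
      simp only [Function.comp, Equiv.subRight_apply]
      rw [mul_assoc, ← zpow_add_one₀ hz, sub_add_cancel]
    have down := (Equiv.addRight (1 : ℤ)).hasSum_iff.2 (ih.mul_right z⁻¹)
    have hdown (k : ℤ) : ((fun k : ℤ => (c k : ℂ) * z ^ k * z⁻¹) ∘ Equiv.addRight (1 : ℤ)) k =
        (c (k + 1) : ℂ) * z ^ k := by
      simp only [Function.comp, Equiv.coe_addRight]
      rw [mul_assoc, ← zpow_sub_one₀ hz, add_sub_cancel_right]
    replace up := (funext hup) ▸ up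
    replace down := (funext hdown) ▸ down
    have d1 : (1 - (q ^ 2) ^ (2 * (n : ℤ) + 1)) ≠ 0 := by
      refine (sub_pos.2 ?_).ne'
      exact_mod_cast pow_lt_one₀ hQ0.le hQ1 (Nat.succ_ne_zero (2 * n))
    have d2 : (1 - (q ^ 2) ^ (2 * (n : ℤ) + 2)) ≠ 0 := by
      refine (sub_pos.2 ?_).ne'
      exact_mod_cast pow_lt_one₀ hQ0.le hQ1 (Nat.succ_ne_zero (2 * n + 1))
    have d1' : ((1 - (q ^ 2) ^ (2 * (n : ℤ) + 1) : ℝ) : ℂ) ≠ 0 := Complex.ofReal_ne_zero.2 d1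
    have d2' : ((1 - (q ^ 2) ^ (2 * (n : ℤ) + 2) : ℝ) : ℂ) ≠ 0 := Complex.ofReal_ne_zero.2 d2
    have key := (((ih.mul_left (1 + (q : ℂ) ^ (4 * n + 2))).add
      (up.mul_left ((q : ℂ) ^ (2 * n + 1)))).add (down.mul_left ((q : ℂ) ^ (2 * n + 1)))).mul_left
      ((((1 - (q ^ 2) ^ (2 * (n : ℤ) + 1)) * (1 - (q ^ 2) ^ (2 * (n : ℤ) + 2)) : ℝ) : ℂ)⁻¹)
    convert key using 1
    · rfl
    · funext k
      have hrec := congrArg (Complex.ofReal) (invQPoch_recurrence h0 h1 n k)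
      rw [eq_inv_mul_iff_mul_eq₀ (by rw [Complex.ofReal_mul]; exact mul_ne_zero d1' d2')]
      simp only [hc]
      rw [← mul_assoc, ← Complex.ofReal_mul, Nat.cast_add, Nat.cast_one, ← hrec]
      push_cast
      rw [show (4 * (n : ℤ) + 2) = ((4 * n + 2 : ℕ) : ℤ) by push_cast; ring,
        show (2 * (n : ℤ) + 1) = ((2 * n + 1 : ℕ) : ℤ) by push_cast; ring]
      simp only [zpow_natCast]
      ring
    · rw [eq_inv_mul_iff_mul_eq₀ (by rw [Complex.ofReal_mul]; exact mul_ne_zero d1' d2'),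
        Finset.prod_range_succ]
      have e1 := invQPoch_sub_one hQ0 hQ1 (2 * n + 2)
      have e2 := invQPoch_sub_one hQ0 hQ1 (2 * n + 1)
      rw [show (2 * (n : ℤ) + 2 - 1) = 2 * n + 1 by ring] at e1
      rw [show (2 * (n : ℤ) + 1 - 1) = 2 * n by ring, e1] at e2
      rw [e2, show (2 * ((n + 1 : ℕ) : ℤ)) = 2 * n + 2 by push_cast; ring]
      push_cast
      ring

lemma invQPoch_ratio_succ {Q : ℝ} (h0 : 0 < Q) (h1 : Q < 1) (n k : ℕ) :
    invQPoch Q (n - (k + 1 : ℕ)) * invQPoch Q (n + (k + 1 : ℕ)) =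
      (1 - Q ^ ((n : ℤ) - k)) / (1 - Q ^ (n + k + 1)) *
        (invQPoch Q (n - k) * invQPoch Q (n + k)) := by
  have a := invQPoch_sub_one h0 h1 (n - k)
  have b := invQPoch_sub_one h0 h1 (n + k + 1)
  have hd : (1 - Q ^ (n + k + 1)) ≠ 0 := (sub_pos.2 (pow_lt_one₀ h0.le h1 (by lia))).ne'
  have e : Q ^ ((n : ℤ) + k + 1) = Q ^ (n + k + 1) := by exact_mod_cast zpow_natCast Q (n + k + 1)
  rw [e, add_sub_cancel_right] at b
  rw [b, show ((n : ℤ) - (k + 1 : ℕ)) = n - k - 1 by push_cast; ring, a,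
    show ((n : ℤ) + (k + 1 : ℕ)) = n + k + 1 by push_cast; ring]
  field_simp

lemma invQPoch_mul_le {Q : ℝ} (h0 : 0 < Q) (h1 : Q < 1) (n k : ℕ) :
    invQPoch Q (n - k) * invQPoch Q (n + k) ≤ invQPoch Q n ^ 2 := by
  induction k with
  | zero => simp [sq]
  | succ k ih =>
    rcases Nat.lt_or_ge k n with h | h
    · rw [invQPoch_ratio_succ h0 h1]
      refine le_trans (mul_le_of_le_one_left
        (mul_nonneg (invQPoch_nonneg h0 h1 _) (invQPoch_nonneg h0 h1 _)) ?_) ih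
      obtain ⟨m, rfl⟩ := Nat.exists_eq_add_of_lt h
      rw [show (((k + m + 1 : ℕ) : ℤ) - k) = ((m + 1 : ℕ) : ℤ) by push_cast; ring, zpow_natCast]
      refine (div_le_one (sub_pos.2 (pow_lt_one₀ h0.le h1 (by lia)))).2 ?_
      exact sub_le_sub_left (pow_le_pow_of_le_one h0.le h1.le (by lia)) _
    · rw [invQPoch_of_neg Q (by push_cast; lia), zero_mul]
      positivity

lemma tendsto_invQPoch_ratio {Q : ℝ} (h0 : 0 < Q) (h1 : Q < 1) (k : ℕ) :
    Filter.Tendsto (fun n : ℕ => invQPoch Q (n - k) * invQPoch Q (n + k) / invQPoch Q n ^ 2)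
      Filter.atTop (nhds 1) := by
  induction k with
  | zero =>
    refine tendsto_const_nhds.congr fun n => ?_
    have := (invQPoch_pos h0 h1 (Int.natCast_nonneg n)).ne'
    simp only [Nat.cast_zero, sub_zero, add_zero]
    field_simp
  | succ k ih =>
    have hp := tendsto_pow_atTop_nhds_zero_of_lt_one h0.le h1
    have num : Filter.Tendsto (fun n : ℕ => 1 - Q ^ ((n : ℤ) - k)) Filter.atTop (nhds 1) := by
      have : Filter.Tendsto (fun n : ℕ => 1 - Q ^ n / Q ^ k) Filter.atTop (nhds (1 - 0 / Q ^ k)) :=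
        tendsto_const_nhds.sub (hp.div_const _)
      rw [zero_div, sub_zero] at this
      refine this.congr fun n => ?_
      rw [zpow_sub₀ h0.ne', zpow_natCast, zpow_natCast]
    have den : Filter.Tendsto (fun n : ℕ => 1 - Q ^ (n + k + 1)) Filter.atTop (nhds 1) := by
      have := tendsto_const_nhds (x := (1 : ℝ)).sub ((Filter.tendsto_add_atTop_iff_nat (k + 1)).2 hp)
      simpa [← add_assoc] using this
    have := (num.div den one_ne_zero).mul ih
    rw [div_one, one_mul] at this
    refine this.congr fun n => ?_
    rw [invQPoch_ratio_succ h0 h1, Pi.div_apply]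
    ring

/-- A factor `1 + 2 q^{2r+1} x + q^{4r+2}` of the Jacobi triple product, as a function of
`x = cos 2πβ`. -/
noncomputable def tripleFactor (q : ℝ) (r : ℕ) (x : ℝ) : ℝ :=
  1 + q ^ (4 * r + 2) + 2 * q ^ (2 * r + 1) * x

lemma tendsto_prod_tripleFactor {t : ℝ} (ht : 0 < t) (β : ℝ) :
    Filter.Tendsto (fun n : ℕ =>
      invQPoch (Real.exp (-Real.pi * t) ^ 2) (2 * n) / invQPoch (Real.exp (-Real.pi * t) ^ 2) n ^ 2 *
        ∏ r ∈ Finset.range n, tripleFactor (Real.exp (-Real.pi * t)) r (Real.cos (2 * Real.pi * β)))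
      Filter.atTop (nhds (HurwitzZeta.cosKernel β t)) := by
  set q := Real.exp (-Real.pi * t) with hq
  have h0 : 0 < q := Real.exp_pos _
  have h1 : q < 1 := Real.exp_lt_one_iff.2 (by nlinarith [Real.pi_pos])
  have hQ0 : 0 < q ^ 2 := by positivity
  have hQ1 : q ^ 2 < 1 := pow_lt_one₀ h0.le h1 two_ne_zero
  set z : ℂ := Complex.exp ((2 * Real.pi * β : ℝ) * Complex.I) with hz
  have hz0 : z ≠ 0 := Complex.exp_ne_zero _
  have hznorm : ‖z‖ = 1 := Complex.norm_exp_ofReal_mul_I _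
  have hzcos : z + z⁻¹ = ((2 * Real.cos (2 * Real.pi * β) : ℝ) : ℂ) := by
    rw [hz, ← Complex.exp_neg, Complex.ofReal_mul 2, Complex.ofReal_cos, Complex.ofReal_ofNat,
      Complex.two_cos, neg_mul]
  have hqk (k : ℤ) : Real.exp (-Real.pi * k ^ 2 * t) = q ^ (k ^ 2) := by
    rw [hq, ← Real.rpow_intCast, ← Real.exp_mul]; congr 1; push_cast; ring
  have hzk (k : ℤ) : Complex.exp (2 * Real.pi * Complex.I * β * k) = z ^ k := by
    rw [hz, ← Complex.exp_int_mul]; congr 1; push_cast; ring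
  have hlim := HurwitzZeta.hasSum_int_cosKernel β ht
  simp only [hqk, hzk] at hlim
  have hnorm (k : ℤ) : ‖z ^ k * ((q ^ (k ^ 2) : ℝ) : ℂ)‖ = q ^ (k ^ 2) := by
    rw [norm_mul, norm_zpow, hznorm, one_zpow, one_mul, Complex.norm_real, Real.norm_of_nonneg]
    positivity
  have hsum : Summable fun k : ℤ => q ^ (k ^ 2) := hlim.summable.norm.congr hnorm
  set ρ : ℕ → ℤ → ℝ := fun n k =>
    invQPoch (q ^ 2) (n - k) * invQPoch (q ^ 2) (n + k) / invQPoch (q ^ 2) n ^ 2 with hρ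
  have hρabs (n : ℕ) (k : ℤ) : ρ n k = ρ n k.natAbs := by
    rcases Int.natAbs_eq k with h | h
    · rw [← h]
    · conv_lhs => rw [h]
      simp only [hρ, sub_neg_eq_add, ← sub_eq_add_neg]
      rw [mul_comm (invQPoch _ (_ + _))]
  have hρ0 (n : ℕ) (k : ℤ) : 0 ≤ ρ n k :=
    div_nonneg (mul_nonneg (invQPoch_nonneg hQ0 hQ1 _) (invQPoch_nonneg hQ0 hQ1 _)) (sq_nonneg _)
  have hρ1 (n : ℕ) (k : ℤ) : ρ n k ≤ 1 := by
    rw [hρabs]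
    exact div_le_one_of_le₀ (invQPoch_mul_le hQ0 hQ1 n _) (sq_nonneg _)
  have hρlim (k : ℤ) : Filter.Tendsto (fun n => ρ n k) Filter.atTop (nhds 1) := by
    simp only [hρabs _ k]
    exact tendsto_invQPoch_ratio hQ0 hQ1 _
  have key := tendsto_tsum_of_dominated_convergence (𝓕 := Filter.atTop)
    (f := fun (n : ℕ) (k : ℤ) => (ρ n k : ℂ) * (z ^ k * ((q ^ (k ^ 2) : ℝ) : ℂ)))
    (g := fun k : ℤ => z ^ k * ((q ^ (k ^ 2) : ℝ) : ℂ)) hsum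
    (fun k => by
      have := (Filter.tendsto_ofReal_iff.2 (hρlim k)).mul_const (z ^ k * ((q ^ (k ^ 2) : ℝ) : ℂ))
      simpa only [Complex.ofReal_one, one_mul] using this)
    (Filter.Eventually.of_forall fun n k => by
      rw [norm_mul, hnorm, Complex.norm_real, Real.norm_of_nonneg (hρ0 n k)]
      exact mul_le_of_le_one_left (by positivity) (hρ1 n k))
  rw [hlim.tsum_eq] at key
  rw [← Filter.tendsto_ofReal_iff]
  refine key.congr fun n => ?_
  have hn := (hasSum_finite_jacobi_triple_product h0 h1 hz0 n).mul_left
    (((invQPoch (q ^ 2) n ^ 2)⁻¹ : ℝ) : ℂ)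
  rw [hzcos] at hn
  have e (k : ℤ) : (((invQPoch (q ^ 2) n ^ 2)⁻¹ : ℝ) : ℂ) * (((q ^ (k ^ 2) *
        (invQPoch (q ^ 2) (n - k) * invQPoch (q ^ 2) (n + k)) : ℝ) : ℂ) * z ^ k) =
      (ρ n k : ℂ) * (z ^ k * ((q ^ (k ^ 2) : ℝ) : ℂ)) := by
    simp only [hρ]
    push_cast
    ring
  simp only [e] at hn
  rw [hn.tsum_eq]
  simp only [tripleFactor]
  push_cast
  rw [div_mul_eq_mul_div, div_eq_inv_mul]
  congr 2
  refine Finset.prod_congr rfl fun r _ => ?_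
  ring

lemma ConvexOn.mul_of_monotoneOn {s : Set ℝ} {f g : ℝ → ℝ} (hf : ConvexOn ℝ s f)
    (hg : ConvexOn ℝ s g) (hf0 : ∀ x ∈ s, 0 ≤ f x) (hg0 : ∀ x ∈ s, 0 ≤ g x)
    (hfm : MonotoneOn f s) (hgm : MonotoneOn g s) : ConvexOn ℝ s (fun x => f x * g x) :=
  hf.mul hg hf0 hg0 (hfm.monovaryOn hgm)

lemma convexOn_affine {s : Set ℝ} (hs : Convex ℝ s) (a b : ℝ) :
    ConvexOn ℝ s (fun x => a + b * x) := by
  refine ⟨hs, fun x _ y _ u v _ _ huv => le_of_eq ?_⟩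
  simp only [smul_eq_mul]
  linear_combination (-a) * huv

lemma tripleFactor_monotoneOn {q : ℝ} (h0 : 0 < q) (r : ℕ) (s : Set ℝ) :
    MonotoneOn (tripleFactor q r) s := fun x _ y _ hxy => by
  unfold tripleFactor
  gcongr

lemma tripleFactor_neg_one (q : ℝ) (r : ℕ) :
    tripleFactor q r (-1) = (1 - q ^ (2 * r + 1)) ^ 2 := by
  unfold tripleFactor
  ring

lemma tripleFactor_pos {q : ℝ} (h0 : 0 < q) (h1 : q < 1) (r : ℕ) {x : ℝ}
    (hx : x ∈ Set.Icc (-1 : ℝ) 1) : 0 < tripleFactor q r x := by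
  have h : 0 < tripleFactor q r (-1) := by
    rw [tripleFactor_neg_one]
    exact pow_pos (sub_pos.2 (pow_lt_one₀ h0.le h1 (by lia))) 2
  exact h.trans_le (tripleFactor_monotoneOn h0 r Set.univ trivial trivial hx.1)

lemma prod_tripleFactor_pos {q : ℝ} (h0 : 0 < q) (h1 : q < 1) (m n : ℕ) {x : ℝ}
    (hx : x ∈ Set.Icc (-1 : ℝ) 1) : 0 < ∏ r ∈ Finset.range n, tripleFactor q (r + m) x :=
  Finset.prod_pos fun _ _ => tripleFactor_pos h0 h1 _ hx

lemma prod_tripleFactor_monotoneOn {q : ℝ} (h0 : 0 < q) (h1 : q < 1) (m n : ℕ) :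
    MonotoneOn (fun x => ∏ r ∈ Finset.range n, tripleFactor q (r + m) x) (Set.Icc (-1) 1) :=
  fun _ hx _ hy hxy => Finset.prod_le_prod (fun _ _ => (tripleFactor_pos h0 h1 _ hx).le)
    fun _ _ => tripleFactor_monotoneOn h0 _ _ hx hy hxy

lemma tripleFactor_convexOn (q : ℝ) (r : ℕ) : ConvexOn ℝ (Set.Icc (-1) 1) (tripleFactor q r) :=
  convexOn_affine (convex_Icc _ _) _ _

lemma prod_tripleFactor_convexOn {q : ℝ} (h0 : 0 < q) (h1 : q < 1) (m n : ℕ) :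
    ConvexOn ℝ (Set.Icc (-1) 1) (fun x => ∏ r ∈ Finset.range n, tripleFactor q (r + m) x) := by
  induction n with
  | zero => simpa using convexOn_const (1 : ℝ) (convex_Icc (-1 : ℝ) 1)
  | succ n ih =>
    simp only [Finset.prod_range_succ]
    exact ih.mul_of_monotoneOn (tripleFactor_convexOn q _)
      (fun x hx => (prod_tripleFactor_pos h0 h1 m n hx).le)
      (fun x hx => (tripleFactor_pos h0 h1 _ hx).le)
      (prod_tripleFactor_monotoneOn h0 h1 m n) (tripleFactor_monotoneOn h0 _ _)

/-- Partial triple products with at least two factors are uniformly strongly convex. -/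
lemma prod_tripleFactor_sub_sq_convexOn {q : ℝ} (h0 : 0 < q) (h1 : q < 1) (n : ℕ) :
    ConvexOn ℝ (Set.Icc (-1) 1) (fun x => (∏ r ∈ Finset.range (n + 2), tripleFactor q r x) -
      4 * q ^ 4 / (tripleFactor q 1 (-1) * tripleFactor q 0 (-1)) *
        (∏ r ∈ Finset.range (n + 2), tripleFactor q r (-1)) * x ^ 2) := by
  have hm1 : (-1 : ℝ) ∈ Set.Icc (-1 : ℝ) 1 := by norm_num
  have hR := prod_tripleFactor_convexOn h0 h1 2 n
  have hRm := prod_tripleFactor_monotoneOn h0 h1 2 n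
  have hR0 := (prod_tripleFactor_pos h0 h1 2 n hm1).le
  have f1 := (tripleFactor_pos h0 h1 1 hm1).ne'
  have f0 := (tripleFactor_pos h0 h1 0 hm1).ne'
  simp only [Finset.prod_range_succ', zero_add, add_assoc, Nat.reduceAdd]
  set R : ℝ → ℝ := fun x => ∏ r ∈ Finset.range n, tripleFactor q (r + 2) x with hRdef
  have hab : ConvexOn ℝ (Set.Icc (-1) 1) (fun x => tripleFactor q 1 x * tripleFactor q 0 x) :=
    (tripleFactor_convexOn q 1).mul_of_monotoneOn (tripleFactor_convexOn q 0)
      (fun x hx => (tripleFactor_pos h0 h1 _ hx).le) (fun x hx => (tripleFactor_pos h0 h1 _ hx).le)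
      (tripleFactor_monotoneOn h0 _ _) (tripleFactor_monotoneOn h0 _ _)
  have hprod : ConvexOn ℝ (Set.Icc (-1) 1)
      (fun x => (R x + -R (-1)) * (tripleFactor q 1 x * tripleFactor q 0 x)) := by
    refine (hR.add_const (-R (-1))).mul_of_monotoneOn hab (fun x hx => ?_) (fun x hx => ?_) ?_ ?_
    · have := hRm hm1 hx hx.1
      simp only [Pi.add_apply]
      linarith
    · exact (mul_pos (tripleFactor_pos h0 h1 _ hx) (tripleFactor_pos h0 h1 _ hx)).le
    · exact hRm.add_const _
    · intro x hx y hy hxy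
      exact mul_le_mul (tripleFactor_monotoneOn h0 _ _ hx hy hxy)
        (tripleFactor_monotoneOn h0 _ _ hx hy hxy) (tripleFactor_pos h0 h1 _ hx).le
        (tripleFactor_pos h0 h1 _ hy).le
  have haff := convexOn_affine (convex_Icc (-1 : ℝ) 1)
    (R (-1) * ((1 + q ^ 6) * (1 + q ^ 2)))
    (R (-1) * ((1 + q ^ 6) * (2 * q) + (2 * q ^ 3) * (1 + q ^ 2)))
  refine (hprod.add haff).congr fun x _ => ?_
  have e : 4 * q ^ 4 / (tripleFactor q 1 (-1) * tripleFactor q 0 (-1)) *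
      (R (-1) * (tripleFactor q 1 (-1) * tripleFactor q 0 (-1))) = 4 * q ^ 4 * R (-1) := by
    field_simp
  simp only [Pi.add_apply, ← mul_assoc] at e ⊢
  change _ = R x * _ * _ - _ * R (-1) * _ * _ * _
  rw [e]
  simp only [tripleFactor]
  ring

lemma ConvexOn.of_tendsto {s : Set ℝ} (hs : Convex ℝ s) {f : ℕ → ℝ → ℝ} {g : ℝ → ℝ}
    (hf : ∀ n, ConvexOn ℝ s (f n))
    (hlim : ∀ x ∈ s, Filter.Tendsto (fun n => f n x) Filter.atTop (nhds (g x))) :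
    ConvexOn ℝ s g :=
  ⟨hs, fun x hx y hy a b ha hb hab => le_of_tendsto_of_tendsto' (hlim _ (hs hx hy ha hb hab))
    (((hlim x hx).const_mul a).add ((hlim y hy).const_mul b))
    fun n => (hf n).2 hx hy ha hb hab⟩

lemma cosKernel_pos (β : ℝ) {t : ℝ} (ht : 0 < t) : 0 < HurwitzZeta.cosKernel β t := by
  have h := HurwitzZeta.hasSum_int_evenKernel β (one_div_pos.2 ht)
  have hpos : 0 < HurwitzZeta.evenKernel β (1 / t) := by
    rw [← h.tsum_eq]
    exact h.summable.tsum_pos (fun _ => (Real.exp_pos _).le) 0 (Real.exp_pos _)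
  rw [HurwitzZeta.evenKernel_functional_equation, one_div_one_div] at hpos
  exact pos_of_mul_pos_right hpos (by positivity)

/-- As a function of `x = cos 2πβ`, the theta function is nondecreasing and strongly convex. -/
lemma cosKernel_arccos_monotoneOn_and_strongConvexOn {t : ℝ} (ht : 0 < t) :
    MonotoneOn (fun x => HurwitzZeta.cosKernel (Real.arccos x / (2 * Real.pi) : ℝ) t)
        (Set.Icc (-1) 1) ∧
      ∃ δ : ℝ, 0 < δ ∧ ConvexOn ℝ (Set.Icc (-1) 1)
        (fun x => HurwitzZeta.cosKernel (Real.arccos x / (2 * Real.pi) : ℝ) t - δ * x ^ 2) := by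
  set q := Real.exp (-Real.pi * t) with hq
  have h0 : 0 < q := Real.exp_pos _
  have h1 : q < 1 := Real.exp_lt_one_iff.2 (by nlinarith [Real.pi_pos])
  have hQ0 : 0 < q ^ 2 := by positivity
  have hQ1 : q ^ 2 < 1 := pow_lt_one₀ h0.le h1 two_ne_zero
  set G : ℝ → ℝ := fun x => HurwitzZeta.cosKernel (Real.arccos x / (2 * Real.pi) : ℝ) t with hG
  set c : ℕ → ℝ := fun n => invQPoch (q ^ 2) (2 * n) / invQPoch (q ^ 2) n ^ 2 with hc
  have hc0 (n : ℕ) : 0 ≤ c n := div_nonneg (invQPoch_nonneg hQ0 hQ1 _) (sq_nonneg _)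
  have hlim : ∀ x ∈ Set.Icc (-1 : ℝ) 1, Filter.Tendsto
      (fun n => c (n + 2) * ∏ r ∈ Finset.range (n + 2), tripleFactor q r x)
      Filter.atTop (nhds (G x)) := fun x hx => by
    have := tendsto_prod_tripleFactor ht (Real.arccos x / (2 * Real.pi))
    rw [mul_div_cancel₀ _ Real.two_pi_pos.ne', Real.cos_arccos hx.1 hx.2] at this
    exact (Filter.tendsto_add_atTop_iff_nat 2).2 this
  have hm1 : (-1 : ℝ) ∈ Set.Icc (-1 : ℝ) 1 := by norm_num
  set κ := 4 * q ^ 4 / (tripleFactor q 1 (-1) * tripleFactor q 0 (-1)) with hκ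
  have hκ0 : 0 < κ := div_pos (by positivity)
    (mul_pos (tripleFactor_pos h0 h1 1 hm1) (tripleFactor_pos h0 h1 0 hm1))
  refine ⟨fun x hx y hy hxy => le_of_tendsto_of_tendsto' (hlim x hx) (hlim y hy) fun n =>
    mul_le_mul_of_nonneg_left (prod_tripleFactor_monotoneOn h0 h1 0 (n + 2) hx hy hxy) (hc0 _),
    κ * G (-1), mul_pos hκ0 (cosKernel_pos _ ht), ?_⟩
  refine ConvexOn.of_tendsto (convex_Icc _ _)
    (fun n => (prod_tripleFactor_sub_sq_convexOn h0 h1 n).smul (hc0 (n + 2))) fun x hx => ?_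
  refine ((hlim x hx).sub (((hlim (-1) hm1).const_mul κ).mul_const (x ^ 2))).congr fun n => ?_
  simp only [smul_eq_mul]
  ring

lemma differentiable_cosKernel {t : ℝ} (ht : 0 < t) :
    Differentiable ℝ (fun b : ℝ => HurwitzZeta.cosKernel b t) := fun b => by
  have h := (differentiableAt_jacobiTheta₂_fst (b : ℂ) (τ := Complex.I * t)
    (by simpa using ht)).hasDerivAt.real_of_complex.differentiableAt
  refine h.congr_of_eventuallyEq (Filter.Eventually.of_forall fun x => ?_)
  simp only [← HurwitzZeta.cosKernel_def, Complex.ofReal_re]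

lemma jacobiThetaShift_eq_evenKernel {t : ℝ} (ht : 0 < t) (β : ℝ) :
    jacobiThetaShift β t = HurwitzZeta.evenKernel β t := by
  rw [← (HurwitzZeta.hasSum_int_evenKernel β ht).tsum_eq, jacobiThetaShift]
  congr 1
  funext k
  ring_nf

lemma jacobiThetaShift_eq_cosKernel {t : ℝ} (ht : 0 < t) (β : ℝ) :
    jacobiThetaShift β t = 1 / t ^ (1 / 2 : ℝ) * HurwitzZeta.cosKernel β (1 / t) := by
  rw [jacobiThetaShift_eq_evenKernel ht, HurwitzZeta.evenKernel_functional_equation]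

lemma Qquot_add_one {t : ℝ} (ht : 0 < t) (β : ℝ) : Qquot t (β + 1) = Qquot t β := by
  have hs : Real.sin (2 * Real.pi * (β + 1)) = Real.sin (2 * Real.pi * β) := by
    rw [mul_add, mul_one, Real.sin_add_two_pi]
  have hp : (fun b => jacobiThetaShift (b + 1) t) = fun b => jacobiThetaShift b t := by
    funext b
    simp [jacobiThetaShift_eq_evenKernel ht]
  rw [Qquot, Qquot, hs, ← deriv_comp_add_const, hp]

lemma Qquot_neg {t : ℝ} (ht : 0 < t) (β : ℝ) : Qquot t (-β) = Qquot t β := by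
  have hp : (fun b => jacobiThetaShift (-b) t) = fun b => jacobiThetaShift b t := by
    funext b
    simp [jacobiThetaShift_eq_evenKernel ht]
  have hd := deriv_comp_neg (fun b => jacobiThetaShift b t) β
  rw [hp] at hd
  rw [Qquot, Qquot, mul_neg, Real.sin_neg, hd, neg_neg, div_neg, neg_div, neg_neg]

lemma Qquot_one_sub {t : ℝ} (ht : 0 < t) (β : ℝ) : Qquot t (1 - β) = Qquot t β := by
  rw [sub_eq_neg_add, Qquot_add_one ht, Qquot_neg ht]

lemma differentiableAt_cosKernel_arccos {t : ℝ} (ht : 0 < t) {x : ℝ} (hx : x ∈ Set.Ioo (-1 : ℝ) 1) :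
    DifferentiableAt ℝ
      (fun x => HurwitzZeta.cosKernel (Real.arccos x / (2 * Real.pi) : ℝ) t) x :=
  (differentiable_cosKernel ht (Real.arccos x / (2 * Real.pi))).fun_comp' x
    ((Real.differentiableAt_arccos.2 ⟨hx.1.ne', hx.2.ne⟩).div_const _)

lemma cos_two_pi_mul_mem_Ioo {β : ℝ} (hβ : β ∈ Set.Ioo (0 : ℝ) (1 / 2)) :
    Real.cos (2 * Real.pi * β) ∈ Set.Ioo (-1 : ℝ) 1 := by
  have hpi := Real.pi_pos
  have h0 : 0 < 2 * Real.pi * β := by have := hβ.1; positivity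
  have h1 : 2 * Real.pi * β < Real.pi := by nlinarith [hβ.2]
  constructor
  · rw [← Real.cos_pi]
    exact Real.cos_lt_cos_of_nonneg_of_le_pi h0.le le_rfl h1
  · rw [← Real.cos_zero]
    exact Real.cos_lt_cos_of_nonneg_of_le_pi le_rfl h1.le h0

lemma Qquot_eq_deriv {t : ℝ} (ht : 0 < t) {β : ℝ} (hβ : β ∈ Set.Ioo (0 : ℝ) (1 / 2)) :
    Qquot t β = 1 / t ^ (1 / 2 : ℝ) * (2 * Real.pi) *
      deriv (fun x => HurwitzZeta.cosKernel (Real.arccos x / (2 * Real.pi) : ℝ) (1 / t))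
        (Real.cos (2 * Real.pi * β)) := by
  have hpi := Real.pi_pos
  have hsin : 0 < Real.sin (2 * Real.pi * β) := by
    apply Real.sin_pos_of_pos_of_lt_pi
    · have := hβ.1
      positivity
    · nlinarith [hβ.2]
  have hcos : HasDerivAt (fun b => Real.cos (2 * Real.pi * b))
      (-Real.sin (2 * Real.pi * β) * (2 * Real.pi * 1)) β :=
    ((hasDerivAt_id β).const_mul (2 * Real.pi)).cos
  have hd := (((differentiableAt_cosKernel_arccos (one_div_pos.2 ht)
    (cos_two_pi_mul_mem_Ioo hβ)).hasDerivAt).comp β hcos).const_mul (1 / t ^ (1 / 2 : ℝ))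
  have heq : (fun b => jacobiThetaShift b t) =ᶠ[nhds β] fun b => 1 / t ^ (1 / 2 : ℝ) *
      ((fun x => HurwitzZeta.cosKernel (Real.arccos x / (2 * Real.pi) : ℝ) (1 / t)) ∘
        fun b => Real.cos (2 * Real.pi * b)) b := by
    filter_upwards [Ioo_mem_nhds hβ.1 hβ.2] with b hb
    have hb0 : 0 ≤ 2 * Real.pi * b := by have := hb.1; positivity
    have hb1 : 2 * Real.pi * b ≤ Real.pi := by nlinarith [hb.2]
    simp only [Function.comp]
    rw [Real.arccos_cos hb0 hb1, mul_div_cancel_left₀ _ Real.two_pi_pos.ne',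
      jacobiThetaShift_eq_cosKernel ht]
  rw [Qquot, (hd.congr_of_eventuallyEq heq).deriv]
  field_simp

lemma deriv_cosKernel_arccos_strictMonoOn {t : ℝ} (ht : 0 < t) :
    StrictMonoOn (deriv (fun x => HurwitzZeta.cosKernel (Real.arccos x / (2 * Real.pi) : ℝ) t))
      (Set.Ioo (-1) 1) := by
  obtain ⟨-, δ, hδ, hconv⟩ := cosKernel_arccos_monotoneOn_and_strongConvexOn ht
  have hderiv : ∀ x ∈ Set.Ioo (-1 : ℝ) 1, HasDerivAt
      (fun x => HurwitzZeta.cosKernel (Real.arccos x / (2 * Real.pi) : ℝ) t - δ * x ^ 2)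
      (deriv (fun x => HurwitzZeta.cosKernel (Real.arccos x / (2 * Real.pi) : ℝ) t) x -
        δ * (2 * x)) x := fun x hx => by
    refine (differentiableAt_cosKernel_arccos ht hx).hasDerivAt.sub ?_
    simpa using (hasDerivAt_pow 2 x).const_mul δ
  have hmono := (hconv.subset Set.Ioo_subset_Icc_self (convex_Ioo _ _)).monotoneOn_deriv
    fun x hx => (hderiv x hx).differentiableAt
  intro x hx y hy hxy
  have := hmono hx hy hxy.le
  rw [(hderiv x hx).deriv, (hderiv y hy).deriv] at this
  nlinarith

lemma deriv_cosKernel_arccos_pos {t : ℝ} (ht : 0 < t) {x : ℝ} (hx : x ∈ Set.Ioo (-1 : ℝ) 1) :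
    0 < deriv (fun x => HurwitzZeta.cosKernel (Real.arccos x / (2 * Real.pi) : ℝ) t) x := by
  obtain ⟨y, hy1, hyx⟩ := exists_between hx.1
  have hy : y ∈ Set.Ioo (-1 : ℝ) 1 := ⟨hy1, hyx.trans hx.2⟩
  refine lt_of_le_of_lt ?_ (deriv_cosKernel_arccos_strictMonoOn ht hy hx hyx)
  rw [← derivWithin_of_mem_nhds (Icc_mem_nhds hy.1 hy.2)]
  exact (cosKernel_arccos_monotoneOn_and_strongConvexOn ht).1.derivWithin_nonneg

lemma Qquot_pos_of_mem_Ioo {t : ℝ} (ht : 0 < t) {β : ℝ} (hβ : β ∈ Set.Ioo (0 : ℝ) (1 / 2)) :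
    0 < Qquot t β := by
  rw [Qquot_eq_deriv ht hβ]
  have := deriv_cosKernel_arccos_pos (one_div_pos.2 ht) (cos_two_pi_mul_mem_Ioo hβ)
  have := Real.pi_pos
  positivity

lemma Qquot_pos {t : ℝ} (ht : 0 < t) {β : ℝ} (hβ : Real.sin (2 * Real.pi * β) ≠ 0) :
    0 < Qquot t β := by
  have hper : Function.Periodic (Qquot t) 1 := Qquot_add_one ht
  have hfr : Qquot t (Int.fract β) = Qquot t β := by
    rw [Int.fract, ← mul_one (⌊β⌋ : ℝ)]
    exact hper.sub_int_mul_eq ⌊β⌋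
  have hsin : Real.sin (2 * Real.pi * Int.fract β) ≠ 0 := by
    rw [Int.fract, mul_sub, mul_comm _ (⌊β⌋ : ℝ), Real.sin_sub_int_mul_two_pi]
    exact hβ
  rw [← hfr]
  have h0 : 0 < Int.fract β := (Int.fract_nonneg β).lt_of_ne' fun h => by simp [h] at hsin
  rcases lt_trichotomy (Int.fract β) (1 / 2) with h | h | h
  · exact Qquot_pos_of_mem_Ioo ht ⟨h0, h⟩
  · refine absurd ?_ hsin
    rw [h, show 2 * Real.pi * (1 / 2) = Real.pi by ring, Real.sin_pi]
  · rw [← Qquot_one_sub ht]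
    exact Qquot_pos_of_mem_Ioo ht ⟨by linarith [Int.fract_lt_one β], by linarith⟩

lemma Qquot_strictAntiOn {t : ℝ} (ht : 0 < t) : StrictAntiOn (Qquot t) (Set.Ioo 0 (1 / 2)) := by
  intro a ha b hb hab
  have hpi := Real.pi_pos
  rw [Qquot_eq_deriv ht ha, Qquot_eq_deriv ht hb]
  refine mul_lt_mul_of_pos_left (deriv_cosKernel_arccos_strictMonoOn (one_div_pos.2 ht)
    (cos_two_pi_mul_mem_Ioo hb) (cos_two_pi_mul_mem_Ioo ha) ?_) (by positivity)
  refine Real.cos_lt_cos_of_nonneg_of_le_pi ?_ ?_ (by gcongr)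
  · have := ha.1
    positivity
  · nlinarith [hb.2]

/-- Montgomery's lemma on `Q`: for each fixed `t > 0`, `Q(·;t)` is strictly positive wherever
`sin(2πβ) ≠ 0`, is 1-periodic and even, strictly decreasing on `(0,1/2)` and strictly
increasing on `(1/2,1)`. -/
theorem Qquot_properties (t : ℝ) (ht : 0 < t) :
    (∀ β : ℝ, Real.sin (2 * Real.pi * β) ≠ 0 → 0 < Qquot t β) ∧
    (∀ β : ℝ, Qquot t (β + 1) = Qquot t β) ∧
    (∀ β : ℝ, Qquot t (-β) = Qquot t β) ∧
    StrictAntiOn (Qquot t) (Set.Ioo 0 (1 / 2)) ∧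
    StrictMonoOn (Qquot t) (Set.Ioo (1 / 2) 1) := by
  refine ⟨fun β hβ => Qquot_pos ht hβ, Qquot_add_one ht, Qquot_neg ht, Qquot_strictAntiOn ht, ?_⟩
  intro a ha b hb hab
  rw [← Qquot_one_sub ht a, ← Qquot_one_sub ht b]
  exact Qquot_strictAntiOn ht ⟨by linarith [hb.2], by linarith [hb.1]⟩
    ⟨by linarith [ha.2], by linarith [ha.1]⟩ (by linarith)
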